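/- There do not exist real numbers a₁₁, a₂₂, a₁₂, b₁, b₂ with (a₁₁ − 1)(a₂₂ − 1) > a₁₂², a₁₁ − 1 > 0, a₂₂ − 1 > 0 that simultaneously satisfy b₁a₁₂ − b₂(a₁₁ − 1) > 0, b₁a₁₂ − b₂(a₁₁ + 1) ≤ 0, b₂a₁₂ − b₁(a₂₂ + 1) > 0, and b₂a₁₂ − b₁(a₂₂ − 1) ≤ 0. -/

import Mathlib

theorem stmt_11 :
    ¬ ∃ a11 a22 a12 b1 b2 : ℝ,
      (a11 - 1) * (a22 - 1) > a12 ^ 2 ∧ a11 - 1 > 0 ∧ a22 - 1 > 0 ∧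
      b1 * a12 - b2 * (a11 - 1) > 0 ∧
      b1 * a12 - b2 * (a11 + 1) ≤ 0 ∧
      b2 * a12 - b1 * (a22 + 1) > 0 ∧
      b2 * a12 - b1 * (a22 - 1) ≤ 0 := by
  rintro ⟨a, d, c, x, y, h, hp, hq, h1, h2, h3, h4⟩
  have hy : 0 < y := by linarith
  have hx : x < 0 := by linarith
  have hc : c < 0 := by
    by_contra hc
    have e1 := mul_nonneg (neg_nonneg.2 hx.le) (not_lt.1 hc)
    have e2 := mul_pos hy hp
    linarith
  have e1 := mul_pos h1 hq
  have e2 := mul_nonneg_of_nonpos_of_nonpos h4 hc.le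
  have e3 := mul_pos hy (sub_pos.2 h)
  nlinarith
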